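/- arXiv:2306.05804 — 4 statements merged into one kernel-verified Lean document; each statement's English description precedes it below -/
import Mathlib

section
/- Pauli path integral identity: for every n, L ≥ 1 and all 2^n × 2^n complex matrices H, ρ, U₁, …, U_L, Tr(H · U_L ⋯ U₁ · ρ · U₁ᴴ ⋯ U_Lᴴ) = Σ_{s ∈ 𝐏ₙ^{L+1}} f(s), the sum ranging over all Pauli paths s = (s₀, …, s_L). -/
open Matrix Complex

noncomputable section

/-- The 2×2 Pauli matrices, indexed by `Fin 4`: identity `I₂`, `X`, `Y`, `Z`. -/
def pauliMat : Fin 4 → Matrix (Fin 2) (Fin 2) ℂ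
  | 0 => 1
  | 1 => !![0, 1; 1, 0]
  | 2 => !![0, -Complex.I; Complex.I, 0]
  | 3 => !![1, 0; 0, -1]

/-- The `n`-qubit Pauli word `P₁ ⊗ ⋯ ⊗ Pₙ` (iterated Kronecker product), where the
`2^n`-dimensional space is encoded by the index type `Fin n → Fin 2`. -/
def pauliWord {n : ℕ} (p : Fin n → Fin 4) :
    Matrix (Fin n → Fin 2) (Fin n → Fin 2) ℂ :=
  fun x y => ∏ i, pauliMat (p i) (x i) (y i)

/-- Hamming weight of a Pauli word: the number of non-identity tensor factors. -/
def pauliWeight {n : ℕ} (p : Fin n → Fin 4) : ℕ :=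
  (Finset.univ.filter fun i => p i ≠ 0).card

/-- The normalized Pauli word `2^(-n/2) • (P₁ ⊗ ⋯ ⊗ Pₙ)`. -/
def normPauli {n : ℕ} (p : Fin n → Fin 4) :
    Matrix (Fin n → Fin 2) (Fin n → Fin 2) ℂ :=
  ((Real.sqrt 2 : ℂ))⁻¹ ^ n • pauliWord p

/-- The contribution `f(s)` of a Pauli path `s = (s₀, …, s_L)`:
`f(s) = Tr(H s_L) · (∏_{i=1}^{L} Tr(sᵢ Uᵢ s_{i−1} Uᵢᴴ)) · Tr(s₀ ρ)`. -/
def pathContrib {n L : ℕ} (H ρ : Matrix (Fin n → Fin 2) (Fin n → Fin 2) ℂ)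
    (U : Fin L → Matrix (Fin n → Fin 2) (Fin n → Fin 2) ℂ)
    (s : Fin (L + 1) → (Fin n → Fin 4)) : ℂ :=
  (H * normPauli (s (Fin.last L))).trace *
    (∏ i : Fin L,
      (normPauli (s i.succ) * U i * normPauli (s i.castSucc) * (U i)ᴴ).trace) *
    (normPauli (s 0) * ρ).trace

/-- Completeness of the single-qubit Pauli matrices. -/
theorem sum_pauliMat_mul_pauliMat (a b c d : Fin 2) :
    ∑ p : Fin 4, pauliMat p a b * pauliMat p c d = if a = d ∧ b = c then 2 else 0 := by
  fin_cases a <;> fin_cases b <;> fin_cases c <;> fin_cases d <;>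
    simp [Fin.sum_univ_four, pauliMat] <;> norm_num

/-- Completeness of the Pauli words, entrywise. -/
theorem sum_normPauli_mul_normPauli {n : ℕ} (a b c d : Fin n → Fin 2) :
    ∑ p : Fin n → Fin 4, normPauli p a b * normPauli p c d = if a = d ∧ b = c then 1 else 0 := by
  have hs : ((Real.sqrt 2 : ℂ))⁻¹ * ((Real.sqrt 2 : ℂ))⁻¹ = 2⁻¹ := by
    rw [← mul_inv, ← Complex.ofReal_mul, Real.mul_self_sqrt (by norm_num)]
    norm_num
  have hprod : ∑ p : Fin n → Fin 4, pauliWord p a b * pauliWord p c d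
      = ∏ i, if a i = d i ∧ b i = c i then (2 : ℂ) else 0 := by
    simp only [pauliWord, ← Finset.prod_mul_distrib, ← sum_pauliMat_mul_pauliMat]
    rw [Finset.prod_univ_sum, Fintype.piFinset_univ]
  have hfactor : ∑ p : Fin n → Fin 4, normPauli p a b * normPauli p c d
      = (2⁻¹ : ℂ) ^ n * ∑ p : Fin n → Fin 4, pauliWord p a b * pauliWord p c d := by
    rw [Finset.mul_sum]
    refine Finset.sum_congr rfl fun p _ => ?_
    simp only [normPauli, Matrix.smul_apply, smul_eq_mul]
    rw [← hs, mul_pow]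
    ring
  rw [hfactor, hprod]
  split_ifs with h
  · obtain ⟨rfl, rfl⟩ := h
    simp
  · have : ∃ i, ¬ (a i = d i ∧ b i = c i) := by
      by_contra! hcon
      exact h ⟨funext fun i => (hcon i).1, funext fun i => (hcon i).2⟩
    obtain ⟨i, hi⟩ := this
    rw [Finset.prod_eq_zero (Finset.mem_univ i) (if_neg hi), mul_zero]

/-- Every matrix is the sum of its components along the normalized Pauli words. -/
theorem sum_trace_smul_normPauli {n : ℕ} (A : Matrix (Fin n → Fin 2) (Fin n → Fin 2) ℂ) :
    ∑ p : Fin n → Fin 4, (normPauli p * A).trace • normPauli p = A := by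
  ext c d
  simp only [Matrix.sum_apply, Matrix.smul_apply, smul_eq_mul, Matrix.trace, Matrix.diag_apply,
    Matrix.mul_apply, Finset.sum_mul]
  rw [Finset.sum_comm]
  have key (x y : Fin n → Fin 2) : ∑ p : Fin n → Fin 4, normPauli p x y * A y x * normPauli p c d
      = if x = d ∧ y = c then A y x else 0 := by
    calc _ = (∑ p : Fin n → Fin 4, normPauli p x y * normPauli p c d) * A y x := by
          rw [Finset.sum_mul]
          exact Finset.sum_congr rfl fun p _ => by ring
      _ = _ := by rw [sum_normPauli_mul_normPauli]; split_ifs <;> simp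
  calc _ = ∑ x, ∑ y, ∑ p : Fin n → Fin 4, normPauli p x y * A y x * normPauli p c d :=
        Finset.sum_congr rfl fun x _ => Finset.sum_comm
    _ = A c d := by simp [key, ite_and]

/-- The trace pairing of two matrices expanded over the normalized Pauli words. -/
theorem trace_mul_eq_sum_normPauli {n : ℕ} (H A : Matrix (Fin n → Fin 2) (Fin n → Fin 2) ℂ) :
    (H * A).trace = ∑ p : Fin n → Fin 4, (H * normPauli p).trace * (normPauli p * A).trace := by
  conv_lhs => rw [← sum_trace_smul_normPauli A]
  simp [Matrix.mul_sum, Matrix.trace_sum, mul_comm]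

/-- The path sum for circuits of any depth, including the empty one. -/
theorem trace_foldl_conj_eq_sum_pathContrib {n L : ℕ}
    (H ρ : Matrix (Fin n → Fin 2) (Fin n → Fin 2) ℂ)
    (U : Fin L → Matrix (Fin n → Fin 2) (Fin n → Fin 2) ℂ) :
    (H * (List.ofFn U).foldl (fun A W => W * A * Wᴴ) ρ).trace
      = ∑ s : Fin (L + 1) → (Fin n → Fin 4), pathContrib H ρ U s := by
  induction L generalizing ρ with
  | zero =>
    rw [← (Equiv.funUnique (Fin 1) (Fin n → Fin 4)).symm.sum_comp]
    simpa [pathContrib] using trace_mul_eq_sum_normPauli H ρ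
  | succ L ih =>
    rw [List.ofFn_succ, List.foldl_cons, ih,
      ← (Fin.consEquiv fun _ : Fin (L + 2) => Fin n → Fin 4).sum_comp, Fintype.sum_prod_type,
      Finset.sum_comm]
    refine Finset.sum_congr rfl fun s _ => ?_
    have hs : (normPauli (s 0) * (U 0 * ρ * (U 0)ᴴ)).trace = ∑ p : Fin n → Fin 4,
        (normPauli (s 0) * U 0 * normPauli p * (U 0)ᴴ).trace * (normPauli p * ρ).trace := by
      have hcyc (B : Matrix (Fin n → Fin 2) (Fin n → Fin 2) ℂ) :
          (normPauli (s 0) * U 0 * B * (U 0)ᴴ).trace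
            = ((U 0)ᴴ * (normPauli (s 0) * U 0) * B).trace := by
        rw [Matrix.trace_mul_comm]
        simp only [Matrix.mul_assoc]
      simp only [hcyc]
      rw [← trace_mul_eq_sum_normPauli, ← hcyc]
      simp only [Matrix.mul_assoc]
    rw [pathContrib, hs, Finset.mul_sum]
    refine Finset.sum_congr rfl fun p _ => ?_
    simp only [pathContrib, Fin.consEquiv_apply, Fin.prod_univ_succ, ← Fin.succ_last,
      Fin.cons_succ, Fin.castSucc_zero, Fin.cons_zero, ← Fin.succ_castSucc]
    ring

/-- Pauli path integral identity:
`Tr(H · U_L ⋯ U₁ · ρ · U₁ᴴ ⋯ U_Lᴴ) = Σ_{s ∈ 𝐏ₙ^{L+1}} f(s)`. -/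
theorem pauli_path_integral (n L : ℕ) (hn : 1 ≤ n) (hL : 1 ≤ L)
    (H ρ : Matrix (Fin n → Fin 2) (Fin n → Fin 2) ℂ)
    (U : Fin L → Matrix (Fin n → Fin 2) (Fin n → Fin 2) ℂ) :
    (H * (List.ofFn U).foldl (fun A W => W * A * Wᴴ) ρ).trace
      = ∑ s : Fin (L + 1) → (Fin n → Fin 4), pathContrib H ρ U s := by
  exact trace_foldl_conj_eq_sum_pathContrib H ρ U
end
end

section
/- Noise suppression of Pauli path contributions (Lemma 1): for every λ ∈ [0, 1], all 2^n × 2^n complex matrices H, ρ, U₁, …, U_L, and every Pauli path s = (s₀, …, s_L) ∈ 𝐏ₙ^{L+1}, the noisy contribution f̂(s) = Tr(H 𝒩(s_L)) · (∏_{i=1}^{L} Tr(sᵢ Uᵢ 𝒩(s_{i−1}) Uᵢᴴ)) · Tr(s₀ ρ) satisfies f̂(s) = (1 − λ)^{|s|} · f(s). -/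
open Matrix Complex

noncomputable section

/-- The single-qubit depolarizing channel `N_λ(A) = (1 − λ)·A + (λ·Tr(A)/2)·I₂`. -/
def depol (lam : ℝ) (A : Matrix (Fin 2) (Fin 2) ℂ) : Matrix (Fin 2) (Fin 2) ℂ :=
  ((1 - lam : ℝ) : ℂ) • A + (((lam : ℝ) : ℂ) * A.trace / 2) • (1 : Matrix (Fin 2) (Fin 2) ℂ)

/-- The Kronecker product `m₁ ⊗ ⋯ ⊗ mₙ` of a family of 2×2 matrices. -/
def tensorAll {n : ℕ} (m : Fin n → Matrix (Fin 2) (Fin 2) ℂ) :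
    Matrix (Fin n → Fin 2) (Fin n → Fin 2) ℂ :=
  fun x y => ∏ i, m i (x i) (y i)

/-- `𝒩(s) = 2^(−n/2) · N_λ(P₁) ⊗ ⋯ ⊗ N_λ(Pₙ)` for a normalized Pauli word
`s = 2^(−n/2) · P₁ ⊗ ⋯ ⊗ Pₙ`. -/
def noisyNormPauli (lam : ℝ) {n : ℕ} (p : Fin n → Fin 4) :
    Matrix (Fin n → Fin 2) (Fin n → Fin 2) ℂ :=
  ((Real.sqrt 2 : ℂ))⁻¹ ^ n • tensorAll (fun i => depol lam (pauliMat (p i)))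

theorem depol_pauliMat (lam : ℝ) (k : Fin 4) :
    depol lam (pauliMat k) = (if k ≠ 0 then ((1 - lam : ℝ) : ℂ) else 1) • pauliMat k := by
  fin_cases k <;> ext i j <;> fin_cases i <;> fin_cases j <;>
    simp [depol, pauliMat, Matrix.trace_fin_two]

theorem tensorAll_smul {n : ℕ} (c : Fin n → ℂ) (m : Fin n → Matrix (Fin 2) (Fin 2) ℂ) :
    tensorAll (fun i => c i • m i) = (∏ i, c i) • tensorAll m := by
  ext x y
  simp [tensorAll, Finset.prod_mul_distrib]

theorem noisyNormPauli_eq_smul (lam : ℝ) {n : ℕ} (p : Fin n → Fin 4) :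
    noisyNormPauli lam p = ((1 - lam : ℝ) : ℂ) ^ pauliWeight p • normPauli p := by
  have hprod : (∏ i, if p i ≠ 0 then ((1 - lam : ℝ) : ℂ) else 1) =
      ((1 - lam : ℝ) : ℂ) ^ pauliWeight p := by
    rw [← Finset.prod_filter, Finset.prod_const, pauliWeight]
  have hword : tensorAll (fun i => pauliMat (p i)) = pauliWord p := rfl
  simp only [noisyNormPauli, depol_pauliMat]
  rw [tensorAll_smul, hprod, hword, normPauli, smul_comm]

/-- Noise suppression of Pauli path contributions (Lemma 1): the noisy contribution
`f̂(s) = Tr(H 𝒩(s_L)) · (∏ᵢ Tr(sᵢ Uᵢ 𝒩(s_{i−1}) Uᵢᴴ)) · Tr(s₀ ρ)` equals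
`(1 − λ)^{|s|} · f(s)`. -/
theorem noisy_path_contribution (lam : ℝ) (hlam : lam ∈ Set.Icc (0 : ℝ) 1)
    (n L : ℕ) (H ρ : Matrix (Fin n → Fin 2) (Fin n → Fin 2) ℂ)
    (U : Fin L → Matrix (Fin n → Fin 2) (Fin n → Fin 2) ℂ)
    (s : Fin (L + 1) → (Fin n → Fin 4)) :
    (H * noisyNormPauli lam (s (Fin.last L))).trace *
      (∏ i : Fin L,
        (normPauli (s i.succ) * U i * noisyNormPauli lam (s i.castSucc) * (U i)ᴴ).trace) *
      (normPauli (s 0) * ρ).trace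
    = ((1 - lam : ℝ) : ℂ) ^ (∑ i, pauliWeight (s i)) *
      ((H * normPauli (s (Fin.last L))).trace *
        (∏ i : Fin L,
          (normPauli (s i.succ) * U i * normPauli (s i.castSucc) * (U i)ᴴ).trace) *
        (normPauli (s 0) * ρ).trace) := by
  simp only [noisyNormPauli_eq_smul, Matrix.mul_smul, Matrix.smul_mul, Matrix.trace_smul,
    smul_eq_mul, Finset.prod_mul_distrib, Finset.prod_pow_eq_pow_sum, Fin.sum_univ_castSucc,
    pow_add]
  ring
end
end

section
/- Noisy Pauli path integral: for every λ ∈ [0, 1], every n, L ≥ 1, and all 2^n × 2^n complex matrices H, ρ, U₁, …, U_L, Tr(H · 𝒩(U_L · 𝒩(⋯ U₁ · 𝒩(ρ) · U₁ᴴ ⋯) · U_Lᴴ)) = Σ_{s ∈ 𝐏ₙ^{L+1}} (1 − λ)^{|s|} · f(s), where 𝒩 is applied once to ρ, once after each of the L layers, and the sum ranges over all Pauli paths. -/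
open Matrix Complex

noncomputable section

/-- The `n`-qubit depolarizing map
`𝒩(A) = Σ_{s ∈ 𝐏ₙ} (1 − λ)^{w(s)} · Tr(s A) · s`. -/
def depolMap (lam : ℝ) {n : ℕ} (A : Matrix (Fin n → Fin 2) (Fin n → Fin 2) ℂ) :
    Matrix (Fin n → Fin 2) (Fin n → Fin 2) ℂ :=
  ∑ p : Fin n → Fin 4,
    (((1 - lam : ℝ) : ℂ) ^ pauliWeight p * (normPauli p * A).trace) • normPauli p

/-- The noisy evolution of `ρ`, expanded over Pauli paths. -/
theorem foldl_depolMap_eq_sum (lam : ℝ) {n L : ℕ}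
    (ρ : Matrix (Fin n → Fin 2) (Fin n → Fin 2) ℂ)
    (U : Fin L → Matrix (Fin n → Fin 2) (Fin n → Fin 2) ℂ) :
    (List.ofFn U).foldl (fun A W => depolMap lam (W * A * Wᴴ)) (depolMap lam ρ)
      = ∑ s : Fin (L + 1) → (Fin n → Fin 4),
          (((1 - lam : ℝ) : ℂ) ^ (∑ i, pauliWeight (s i)) *
            ((∏ i : Fin L,
              (normPauli (s i.succ) * U i * normPauli (s i.castSucc) * (U i)ᴴ).trace) *
            (normPauli (s 0) * ρ).trace)) • normPauli (s (Fin.last L)) := by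
  induction L with
  | zero =>
    rw [← (Equiv.funUnique (Fin 1) (Fin n → Fin 4)).symm.sum_comp]
    simp [depolMap]
  | succ L ih =>
    rw [List.ofFn_succ', List.concat_eq_append, List.foldl_append, ih]
    rw [← (Fin.snocEquiv fun _ : Fin (L + 2) => Fin n → Fin 4).sum_comp, Fintype.sum_prod_type]
    simp only [List.foldl_cons, List.foldl_nil, depolMap, Fin.snocEquiv_apply]
    refine Finset.sum_congr rfl fun p _ => ?_
    simp only [Fin.snoc_last, ← Finset.sum_smul]
    congr 1
    simp only [Finset.mul_sum, Finset.sum_mul, Matrix.trace_sum, Matrix.mul_smul,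
      Matrix.smul_mul, Matrix.trace_smul, smul_eq_mul]
    refine Finset.sum_congr rfl fun s _ => ?_
    rw [Fin.sum_univ_castSucc (n := L + 1), Fin.prod_univ_castSucc, pow_add]
    simp only [Fin.snoc_last, Fin.snoc_castSucc, Fin.succ_last, Fin.succ_castSucc,
      ← Fin.castSucc_zero, Matrix.mul_assoc]
    ring

/-- Noisy Pauli path integral:
`Tr(H · 𝒩(U_L · 𝒩(⋯ U₁ · 𝒩(ρ) · U₁ᴴ ⋯) · U_Lᴴ)) = Σ_s (1 − λ)^{|s|} f(s)`. -/
theorem noisy_pauli_path_integral (lam : ℝ) (hlam : lam ∈ Set.Icc (0 : ℝ) 1)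
    (n L : ℕ) (hn : 1 ≤ n) (hL : 1 ≤ L)
    (H ρ : Matrix (Fin n → Fin 2) (Fin n → Fin 2) ℂ)
    (U : Fin L → Matrix (Fin n → Fin 2) (Fin n → Fin 2) ℂ) :
    (H * (List.ofFn U).foldl (fun A W => depolMap lam (W * A * Wᴴ)) (depolMap lam ρ)).trace
      = ∑ s : Fin (L + 1) → (Fin n → Fin 4),
          ((1 - lam : ℝ) : ℂ) ^ (∑ i, pauliWeight (s i)) * pathContrib H ρ U s := by
  rw [foldl_depolMap_eq_sum, Finset.mul_sum, Matrix.trace_sum]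
  refine Finset.sum_congr rfl fun s _ => ?_
  rw [Matrix.mul_smul, Matrix.trace_smul, smul_eq_mul, pathContrib]
  ring
end
end

section
/- Splitting is equivalent to generating (Lemma E.4): let A be a set of n-qubit Pauli words. The following are equivalent: (i) A splits the Pauli words, i.e., for all n-qubit Pauli words b₁, b₂, if for every a ∈ A one has (b₁·a = a·b₁ ↔ b₂·a = a·b₂), then b₁ = b₂; (ii) A generates all Pauli words up to phase, i.e., every n-qubit Pauli word can be written as c·(a₁ · a₂ ⋯ a_k) for some k ∈ ℕ, elements a₁, …, a_k ∈ A, and some c ∈ {1, i, −1, −i}. -/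
open Matrix Complex

noncomputable section

/-- The symplectic representation of the Pauli labels: `I₂ ↦ (0, 0)`, `X ↦ (1, 0)`,
`Y ↦ (1, 1)`, `Z ↦ (0, 1)`. -/
def pauliEquiv : Fin 4 ≃ ZMod 2 × ZMod 2 where
  toFun := ![(0, 0), (1, 0), (1, 1), (0, 1)]
  invFun v := if v.1 = 0 then (if v.2 = 0 then 0 else 3) else (if v.2 = 0 then 1 else 2)
  left_inv := by decide
  right_inv := by decide

/-- The nontrivial additive character of `ZMod 2` with values in `ℂ`. -/
def signChar (z : ZMod 2) : ℂ := if z = 0 then 1 else -1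

lemma zmod_two_eq_zero_or_one : ∀ z : ZMod 2, z = 0 ∨ z = 1 := by decide

lemma signChar_add (z w : ZMod 2) : signChar (z + w) = signChar z * signChar w := by
  have h : (1 : ZMod 2) + 1 = 0 := by decide
  rcases zmod_two_eq_zero_or_one z with rfl | rfl <;>
    rcases zmod_two_eq_zero_or_one w with rfl | rfl <;> simp [signChar, h]

lemma signChar_eq_one_iff {z : ZMod 2} : signChar z = 1 ↔ z = 0 := by
  unfold signChar
  split_ifs with h
  · simp [h]
  · simp only [h, iff_false]
    norm_num

lemma signChar_sum {ι : Type*} (s : Finset ι) (f : ι → ZMod 2) :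
    signChar (∑ i ∈ s, f i) = ∏ i ∈ s, signChar (f i) := by
  classical
  induction s using Finset.induction_on with
  | empty => simp [signChar]
  | insert a s ha ih => rw [Finset.sum_insert ha, Finset.prod_insert ha, signChar_add, ih]

lemma pauliMat_mul_self (p : Fin 4) : pauliMat p * pauliMat p = 1 := by
  fin_cases p <;> ext i j <;> fin_cases i <;> fin_cases j <;>
    simp [pauliMat, Matrix.mul_apply]

lemma pauliMat_mul_comm (p q : Fin 4) :
    pauliMat p * pauliMat q =
      signChar ((pauliEquiv p).1 * (pauliEquiv q).2 + (pauliEquiv p).2 * (pauliEquiv q).1) •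
        (pauliMat q * pauliMat p) := by
  have h : (1 : ZMod 2) + 1 = 0 := by decide
  fin_cases p <;> fin_cases q <;> ext i j <;> fin_cases i <;> fin_cases j <;>
    simp [pauliMat, pauliEquiv, signChar, Matrix.mul_apply, h]

lemma exists_pauliMat_mul (p q : Fin 4) :
    ∃ c : ℂ, c ^ 4 = 1 ∧
      pauliMat p * pauliMat q = c • pauliMat (pauliEquiv.symm (pauliEquiv p + pauliEquiv q)) := by
  have h : (1 : ZMod 2) + 1 = 0 := by decide
  have hmul : ∃ c ∈ ({1, I, -I} : Set ℂ),
      pauliMat p * pauliMat q = c • pauliMat (pauliEquiv.symm (pauliEquiv p + pauliEquiv q)) := by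
    simp only [Set.mem_insert_iff, Set.mem_singleton_iff, exists_eq_or_imp, exists_eq_left,
      ← Matrix.ext_iff, Fin.forall_fin_two]
    fin_cases p <;> fin_cases q <;>
      simp [pauliMat, pauliEquiv, Matrix.mul_apply, h]
  obtain ⟨c, hc, hpq⟩ := hmul
  refine ⟨c, ?_, hpq⟩
  rcases hc with rfl | rfl | rfl <;> simp [Even.neg_pow (by decide : Even 4)]

lemma pauliWord_mul_apply {n : ℕ} (p q : Fin n → Fin 4) (x y : Fin n → Fin 2) :
    (pauliWord p * pauliWord q) x y = ∏ i, (pauliMat (p i) * pauliMat (q i)) (x i) (y i) := by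
  simp only [Matrix.mul_apply, pauliWord, Finset.prod_univ_sum, Fintype.piFinset_univ,
    Finset.prod_mul_distrib]

lemma pauliWord_zero {n : ℕ} : pauliWord (0 : Fin n → Fin 4) = 1 := by
  ext x y
  simp [pauliWord, pauliMat, Matrix.one_apply, Finset.prod_ite_zero, funext_iff]

lemma pauliWord_mul_self {n : ℕ} (p : Fin n → Fin 4) : pauliWord p * pauliWord p = 1 := by
  ext x y
  simp [pauliWord_mul_apply, pauliMat_mul_self, Matrix.one_apply, Finset.prod_ite_zero,
    funext_iff]

/-- The symplectic representation of the labels of Pauli words. -/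
def pauliVec {n : ℕ} : (Fin n → Fin 4) ≃ (Fin n → ZMod 2 × ZMod 2) :=
  Equiv.arrowCongr (Equiv.refl _) pauliEquiv

lemma pauliVec_symm_apply {n : ℕ} (v : Fin n → ZMod 2 × ZMod 2) (i : Fin n) :
    pauliVec.symm v i = pauliEquiv.symm (v i) := rfl

lemma pauliVec_symm_zero {n : ℕ} : (pauliVec.symm 0 : Fin n → Fin 4) = 0 := by
  ext i
  simp [pauliVec_symm_apply, pauliEquiv]

/-- The standard symplectic form on `(ZMod 2 × ZMod 2) ^ n`. -/
def sympForm {n : ℕ} (v w : Fin n → ZMod 2 × ZMod 2) : ZMod 2 :=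
  ∑ i, ((v i).1 * (w i).2 + (v i).2 * (w i).1)

lemma sympForm_add_left {n : ℕ} (u v w : Fin n → ZMod 2 × ZMod 2) :
    sympForm (u + v) w = sympForm u w + sympForm v w := by
  simp only [sympForm, ← Finset.sum_add_distrib, Pi.add_apply, Prod.fst_add, Prod.snd_add]
  exact Finset.sum_congr rfl fun i _ => by ring

lemma sympForm_zero_left {n : ℕ} (w : Fin n → ZMod 2 × ZMod 2) : sympForm 0 w = 0 := by
  simp [sympForm]

lemma eq_zero_of_sympForm_eq_zero {n : ℕ} {v : Fin n → ZMod 2 × ZMod 2}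
    (h : ∀ w, sympForm v w = 0) : v = 0 := by
  classical
  funext i
  have h₁ := h (Pi.single i (0, 1))
  have h₂ := h (Pi.single i (1, 0))
  rw [sympForm, Finset.sum_eq_single i (fun j _ hj => by simp [hj]) (by simp)] at h₁ h₂
  exact Prod.ext (by simpa using h₁) (by simpa using h₂)

lemma exists_sympForm_eq {n : ℕ} (f : (Fin n → ZMod 2 × ZMod 2) →ₗ[ZMod 2] ZMod 2) :
    ∃ v, ∀ w, sympForm v w = f w := by
  classical
  refine ⟨fun i => (f (Pi.single i (0, 1)), f (Pi.single i (1, 0))), fun w => ?_⟩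
  conv_rhs => rw [← Finset.univ_sum_single w, map_sum]
  refine Finset.sum_congr rfl fun i _ => ?_
  have hw : (Pi.single i (w i) : Fin n → ZMod 2 × ZMod 2) =
      (w i).2 • (Pi.single i (0, 1) : Fin n → ZMod 2 × ZMod 2) +
        (w i).1 • (Pi.single i (1, 0) : Fin n → ZMod 2 × ZMod 2) := by
    rw [← Pi.single_smul, ← Pi.single_smul, ← Pi.single_add]
    simp
  rw [hw, map_add, map_smul, map_smul, smul_eq_mul, smul_eq_mul]
  ring

lemma pauliWord_mul_comm {n : ℕ} (p q : Fin n → Fin 4) :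
    pauliWord p * pauliWord q =
      signChar (sympForm (pauliVec p) (pauliVec q)) • (pauliWord q * pauliWord p) := by
  ext x y
  rw [Matrix.smul_apply, pauliWord_mul_apply, pauliWord_mul_apply, sympForm, signChar_sum,
    smul_eq_mul, ← Finset.prod_mul_distrib]
  refine Finset.prod_congr rfl fun i _ => ?_
  rw [pauliMat_mul_comm, Matrix.smul_apply, smul_eq_mul]
  rfl

lemma pauliWord_commute_iff {n : ℕ} (p q : Fin n → Fin 4) :
    pauliWord p * pauliWord q = pauliWord q * pauliWord p ↔
      sympForm (pauliVec p) (pauliVec q) = 0 := by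
  have hne : pauliWord q * pauliWord p ≠ 0 := by
    intro h
    have h₁ : pauliWord q * (pauliWord q * pauliWord p) * pauliWord p = 1 := by
      rw [← mul_assoc, pauliWord_mul_self, one_mul, pauliWord_mul_self]
    rw [h, mul_zero, zero_mul] at h₁
    exact zero_ne_one h₁
  rw [pauliWord_mul_comm p q, ← signChar_eq_one_iff]
  refine ⟨fun h => ?_, fun h => by rw [h, one_smul]⟩
  exact smul_left_injective ℂ hne (h.trans (one_smul ℂ _).symm)

lemma exists_pauliWord_mul {n : ℕ} (p q : Fin n → Fin 4) :
    ∃ c : ℂ, c ^ 4 = 1 ∧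
      pauliWord p * pauliWord q = c • pauliWord (pauliVec.symm (pauliVec p + pauliVec q)) := by
  choose c hc hpq using fun i => exists_pauliMat_mul (p i) (q i)
  refine ⟨∏ i, c i, by simp [← Finset.prod_pow, hc], ?_⟩
  ext x y
  simp only [pauliWord_mul_apply, hpq, Matrix.smul_apply, smul_eq_mul, Finset.prod_mul_distrib]
  rfl

lemma exists_prod_pauliWord {n : ℕ} (l : List (Fin n → Fin 4)) :
    ∃ c : ℂ, c ^ 4 = 1 ∧
      pauliWord (pauliVec.symm (l.map pauliVec).sum) = c • (l.map pauliWord).prod := by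
  induction l with
  | nil => exact ⟨1, by simp, by simp [pauliVec_symm_zero, pauliWord_zero]⟩
  | cons a l ih =>
    obtain ⟨c, hc, h⟩ := ih
    obtain ⟨d, hd, h'⟩ := exists_pauliWord_mul a (pauliVec.symm (l.map pauliVec).sum)
    have hd₀ : d ≠ 0 := by
      rintro rfl
      simp at hd
    rw [h, Equiv.apply_symm_apply, mul_smul_comm] at h'
    refine ⟨d⁻¹ * c, by rw [mul_pow, inv_pow, hd, hc, inv_one, one_mul], ?_⟩
    rw [List.map_cons, List.sum_cons, List.map_cons, List.prod_cons, mul_smul, h',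
      inv_smul_smul₀ hd₀]

lemma mem_of_pow_four_eq_one {c : ℂ} (hc : c ^ 4 = 1) : c ∈ ({1, I, -1, -I} : Set ℂ) := by
  have h : (c - 1) * (c - I) * (c + 1) * (c + I) = 0 := by
    linear_combination hc + (1 - c ^ 2) * I_sq
  simp only [mul_eq_zero, sub_eq_zero, add_eq_zero_iff_eq_neg] at h
  simp only [Set.mem_insert_iff, Set.mem_singleton_iff]
  tauto

lemma exists_list_sum_of_sympForm_separating {n : ℕ} (A : Set (Fin n → Fin 4))
    (h : ∀ v, (∀ a ∈ A, sympForm v (pauliVec a) = 0) → v = 0) (b : Fin n → Fin 4) :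
    ∃ l : List (Fin n → Fin 4), (∀ a ∈ l, a ∈ A) ∧ (l.map pauliVec).sum = pauliVec b := by
  have hspan : Submodule.span (ZMod 2) (pauliVec '' A) = ⊤ := by
    by_contra hne
    obtain ⟨f, hf₀, hf⟩ := Submodule.exists_le_ker_of_lt_top _ (lt_top_iff_ne_top.2 hne)
    obtain ⟨v, hv⟩ := exists_sympForm_eq f
    have hv₀ : v = 0 := h v fun a ha => by
      rw [hv]
      exact hf (Submodule.subset_span (Set.mem_image_of_mem _ ha))
    refine hf₀ (LinearMap.ext fun w => ?_)
    rw [← hv, hv₀, sympForm_zero_left, LinearMap.zero_apply]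
  have hb : pauliVec b ∈ Submodule.span (ZMod 2) (pauliVec '' A) := hspan ▸ Submodule.mem_top
  generalize pauliVec b = v at hb
  induction hb using Submodule.span_induction with
  | mem v hv =>
    obtain ⟨a, ha, rfl⟩ := hv
    exact ⟨[a], by simpa using ha, by simp⟩
  | zero => exact ⟨[], by simp, by simp⟩
  | add v w _ _ hv hw =>
    obtain ⟨l, hl, rfl⟩ := hv
    obtain ⟨m, hm, rfl⟩ := hw
    refine ⟨l ++ m, fun a ha => ?_, by simp⟩
    exact (List.mem_append.1 ha).elim (hl a) (hm a)
  | smul z v _ hv =>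
    rcases zmod_two_eq_zero_or_one z with rfl | rfl
    · exact ⟨[], by simp, by simp⟩
    · simpa using hv

/-- Splitting is equivalent to generating: a set `A` of `n`-qubit Pauli words splits the
Pauli words (distinct Pauli words are distinguished by their commutation pattern with `A`)
iff every Pauli word is a finite product of elements of `A` up to a phase in `{1, i, −1, −i}`. -/
theorem pauli_split_iff_generate (n : ℕ) (A : Set (Fin n → Fin 4)) :
    (∀ b₁ b₂ : Fin n → Fin 4,
        (∀ a ∈ A, (pauliWord b₁ * pauliWord a = pauliWord a * pauliWord b₁ ↔
                   pauliWord b₂ * pauliWord a = pauliWord a * pauliWord b₂)) → b₁ = b₂)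
    ↔ (∀ b : Fin n → Fin 4, ∃ (l : List (Fin n → Fin 4)) (c : ℂ),
        (∀ a ∈ l, a ∈ A) ∧ c ∈ ({1, Complex.I, -1, -Complex.I} : Set ℂ) ∧
        pauliWord b = c • (l.map pauliWord).prod) := by
  constructor
  · intro h b
    have hA : ∀ v, (∀ a ∈ A, sympForm v (pauliVec a) = 0) → v = 0 := fun v hv => by
      have hv' : pauliVec.symm v = pauliVec.symm 0 := h _ _ fun a ha => by
        simp only [pauliWord_commute_iff, Equiv.apply_symm_apply, hv a ha, sympForm_zero_left]
      exact pauliVec.symm.injective hv'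
    obtain ⟨l, hl, hsum⟩ := exists_list_sum_of_sympForm_separating A hA b
    obtain ⟨c, hc, hprod⟩ := exists_prod_pauliWord l
    rw [hsum, Equiv.symm_apply_apply] at hprod
    exact ⟨l, c, hl, mem_of_pow_four_eq_one hc, hprod⟩
  · intro h b₁ b₂ hb
    have hA : ∀ a ∈ A, sympForm (pauliVec b₁ + pauliVec b₂) (pauliVec a) = 0 := fun a ha => by
      have hab := hb a ha
      rw [pauliWord_commute_iff, pauliWord_commute_iff] at hab
      rw [sympForm_add_left]
      generalize sympForm (pauliVec b₁) (pauliVec a) = z at hab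
      generalize sympForm (pauliVec b₂) (pauliVec a) = w at hab
      revert z w
      decide
    have hzero : pauliVec b₁ + pauliVec b₂ = 0 := by
      refine eq_zero_of_sympForm_eq_zero fun w => ?_
      obtain ⟨l, c, hl, -, hw⟩ := h (pauliVec.symm w)
      have hcomm : Commute (pauliWord (pauliVec.symm (pauliVec b₁ + pauliVec b₂)))
          (pauliWord (pauliVec.symm w)) := by
        rw [hw]
        refine (Commute.list_prod_right _ _ fun M hM => ?_).smul_right c
        obtain ⟨a, ha, rfl⟩ := List.mem_map.1 hM
        refine (pauliWord_commute_iff _ _).2 ?_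
        rw [Equiv.apply_symm_apply]
        exact hA a (hl a ha)
      simpa using (pauliWord_commute_iff _ _).1 hcomm.eq
    refine pauliVec.injective ?_
    rwa [add_eq_zero_iff_eq_neg, ZModModule.neg_eq_self] at hzero
end
end
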